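/- Assume ρ(A,B) < ∞. Every minimal optimal vector y has at most m positive coordinates, i.e., |supp y| ≤ m. -/

import Mathlib

open Matrix Filter
open scoped ENNReal Topology

/-- `r(A,B,x) = inf{t ∈ [0,∞] : A x ≤ t B x entrywise}`, valued in `ℝ≥0∞`
(the infimum of the empty set being `⊤`). -/
noncomputable def cwR {m n : ℕ} (A B : Matrix (Fin m) (Fin n) ℝ) (x : Fin n → ℝ) : ℝ≥0∞ :=
  sInf {t : ℝ≥0∞ | ∃ s : ℝ, 0 ≤ s ∧ t = ENNReal.ofReal s ∧
    ∀ i, A.mulVec x i ≤ s * B.mulVec x i}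

/-- The Collatz–Wielandt quotient `ρ(A,B) = inf{r(A,B,x) : x > 0 entrywise}`. -/
noncomputable def cwRho {m n : ℕ} (A B : Matrix (Fin m) (Fin n) ℝ) : ℝ≥0∞ :=
  sInf {t : ℝ≥0∞ | ∃ x : Fin n → ℝ, (∀ j, 0 < x j) ∧ t = cwR A B x}

/-- The support of a vector: the set of indices of its positive coordinates. -/
def suppS {n : ℕ} (y : Fin n → ℝ) : Set (Fin n) := {j | 0 < y j}

/-- `y` is optimal for the pair `(A,B)`: `r(A,B,y) = ρ(A,B)` and `y` is a limit of
entrywise positive vectors `y_k` with `r(A,B,y_k) → ρ(A,B)`. -/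
def OptimalVec {m n : ℕ} (A B : Matrix (Fin m) (Fin n) ℝ) (y : Fin n → ℝ) : Prop :=
  (∀ j, 0 ≤ y j) ∧ y ≠ 0 ∧ cwR A B y = cwRho A B ∧
  ∃ yk : ℕ → Fin n → ℝ, (∀ k j, 0 < yk k j) ∧
    Tendsto yk atTop (𝓝 y) ∧
    Tendsto (fun k => cwR A B (yk k)) atTop (𝓝 (cwRho A B))

/-- `y` is minimal optimal: optimal, and no optimal vector has support strictly
contained in the support of `y`. -/
def MinOptimalVec {m n : ℕ} (A B : Matrix (Fin m) (Fin n) ℝ) (y : Fin n → ℝ) : Prop :=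
  OptimalVec A B y ∧ ∀ w : Fin n → ℝ, OptimalVec A B w → ¬ suppS w ⊂ suppS y

/-- A linear map into a space of dimension at most `|S|`, restricted to the vectors supported
on `S`, either has a nontrivial kernel or is surjective. -/
lemma exists_supported_ker_or_forall_exists {n : ℕ} {V : Type*} [AddCommGroup V] [Module ℝ V]
    [FiniteDimensional ℝ V] (L : (Fin n → ℝ) →ₗ[ℝ] V) (S : Set (Fin n))
    (h : Module.finrank ℝ V ≤ S.ncard) :
    (∃ z : Fin n → ℝ, z ≠ 0 ∧ (∀ j, j ∉ S → z j = 0) ∧ L z = 0) ∨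
      ∀ b, ∃ v : Fin n → ℝ, (∀ j, j ∉ S → v j = 0) ∧ L v = b := by
  classical
  let E : (S → ℝ) →ₗ[ℝ] (Fin n → ℝ) := Function.ExtendByZero.linearMap ℝ Subtype.val
  have hE : ∀ z j, j ∉ S → E z j = 0 := fun z j hj =>
    Function.extend_apply' _ _ _ (by rintro ⟨a, rfl⟩; exact hj a.2)
  have hE' : ∀ z (j : S), E z j = z j := fun z j =>
    Subtype.val_injective.extend_apply _ _ _
  by_cases hinj : Function.Injective (L ∘ₗ E)
  · right
    have hfr : Module.finrank ℝ (S → ℝ) = S.ncard := by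
      rw [Module.finrank_fintype_fun_eq_card, ← Nat.card_eq_fintype_card, Nat.card_coe_set_eq]
    have heq : Module.finrank ℝ (S → ℝ) = Module.finrank ℝ V :=
      le_antisymm (LinearMap.finrank_le_finrank_of_injective hinj) (hfr ▸ h)
    have hsurj := (LinearMap.injective_iff_surjective_of_finrank_eq_finrank heq).1 hinj
    intro b
    obtain ⟨v, hv⟩ := hsurj b
    exact ⟨E v, hE v, hv⟩
  · left
    rw [injective_iff_map_eq_zero] at hinj
    push Not at hinj
    obtain ⟨z, hz, hz0⟩ := hinj
    refine ⟨E z, fun h0 => hz0 ?_, hE z, hz⟩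
    ext j
    rw [← hE' z j, h0]
    rfl

/-- Moving from a nonnegative vector `y` along a direction supported on `suppS y`, one reaches
a nonnegative vector of strictly smaller support. -/
lemma exists_sub_smul_suppS_ssubset {n : ℕ} {y z : Fin n → ℝ} (hy : ∀ j, 0 ≤ y j) (hz : z ≠ 0)
    (hzy : ∀ j, j ∉ suppS y → z j = 0) :
    ∃ t : ℝ, (∀ j, 0 ≤ (y - t • z) j) ∧ suppS (y - t • z) ⊂ suppS y := by
  wlog hpos : ∃ j, 0 < z j generalizing z
  · obtain ⟨j, hj⟩ := Function.ne_iff.1 hz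
    push Not at hpos
    obtain ⟨t, ht⟩ := this (z := -z) (neg_ne_zero.2 hz) (fun j hj => by simp [hzy j hj])
      ⟨j, by simpa using lt_of_le_of_ne (hpos j) hj⟩
    exact ⟨-t, by simpa using ht⟩
  obtain ⟨j₀, hj₀⟩ := hpos
  obtain ⟨j, hj, hmin⟩ := (Finset.univ.filter fun j => 0 < z j).exists_min_image
    (fun j => y j / z j) ⟨j₀, by simp [hj₀]⟩
  simp only [Finset.mem_filter, Finset.mem_univ, true_and] at hj hmin
  have hnn : 0 ≤ y j / z j := div_nonneg (hy j) hj.le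
  refine ⟨y j / z j, fun i => ?_, ?_, fun hsub => ?_⟩
  · simp only [Pi.sub_apply, Pi.smul_apply, smul_eq_mul, sub_nonneg]
    rcases le_or_gt (z i) 0 with hi | hi
    · exact (mul_nonpos_of_nonneg_of_nonpos hnn hi).trans (hy i)
    · exact (le_div_iff₀ hi).1 (hmin i hi)
  · intro i hi
    by_contra hiy
    have h1 : ¬ 0 < y i := hiy
    have h2 : 0 < y i - y j / z j * z i := hi
    rw [hzy i hiy, mul_zero, sub_zero] at h2
    exact h1 h2
  · have hjy : j ∈ suppS y := by
      by_contra h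
      exact hj.ne' (hzy j h)
    have h2 : 0 < y j - y j / z j * z j := hsub hjy
    rw [div_mul_cancel₀ _ hj.ne', sub_self] at h2
    exact h2.false

lemma cwR_le_ofReal {m n : ℕ} {A B : Matrix (Fin m) (Fin n) ℝ} {x : Fin n → ℝ} {s : ℝ}
    (hs : 0 ≤ s) (h : ∀ i, A.mulVec x i ≤ s * B.mulVec x i) :
    cwR A B x ≤ ENNReal.ofReal s :=
  sInf_le ⟨s, hs, rfl, h⟩

lemma cwRho_le_cwR {m n : ℕ} {A B : Matrix (Fin m) (Fin n) ℝ} {x : Fin n → ℝ}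
    (hx : ∀ j, 0 < x j) : cwRho A B ≤ cwR A B x :=
  sInf_le ⟨x, hx, rfl⟩

lemma mulVec_le_of_cwR_le {m n : ℕ} {A B : Matrix (Fin m) (Fin n) ℝ} {x : Fin n → ℝ} {s : ℝ}
    (hs : 0 ≤ s) (hB : ∀ i, 0 ≤ B.mulVec x i) (h : cwR A B x ≤ ENNReal.ofReal s) (i : Fin m) :
    A.mulVec x i ≤ s * B.mulVec x i := by
  have key : ∀ᶠ t in 𝓝[>] s, A.mulVec x i ≤ t * B.mulVec x i := by
    filter_upwards [self_mem_nhdsWithin] with t ht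
    have ht' : s < t := ht
    have hlt : cwR A B x < ENNReal.ofReal t :=
      h.trans_lt ((ENNReal.ofReal_lt_ofReal_iff (hs.trans_lt ht')).2 ht')
    obtain ⟨_, ⟨u, -, rfl, hu⟩, hut⟩ := sInf_lt_iff.1 hlt
    exact (hu i).trans (mul_le_mul_of_nonneg_right
      (ENNReal.ofReal_lt_ofReal_iff (hs.trans_lt ht') |>.1 hut).le (hB i))
  refine ge_of_tendsto (Tendsto.mono_left ?_ nhdsWithin_le_nhds) key
  exact (continuous_id.mul continuous_const).tendsto s

lemma cwR_lt_ofReal {m n : ℕ} {A B : Matrix (Fin m) (Fin n) ℝ} {x : Fin n → ℝ} {s : ℝ}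
    (hs : 0 < s) (h : ∀ i, A.mulVec x i < s * B.mulVec x i ∨
      (A.mulVec x i ≤ 0 ∧ 0 ≤ B.mulVec x i)) :
    cwR A B x < ENNReal.ofReal s := by
  have key : ∀ᶠ t in 𝓝[<] s, 0 < t ∧ ∀ i, A.mulVec x i ≤ t * B.mulVec x i := by
    have hpos : ∀ᶠ t in 𝓝[<] s, 0 < t := nhdsWithin_le_nhds (lt_mem_nhds hs)
    refine hpos.and (eventually_all.2 fun i => ?_)
    rcases h i with hi | hi
    · have : Tendsto (fun t => t * B.mulVec x i) (𝓝[<] s) (𝓝 (s * B.mulVec x i)) :=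
        ((continuous_id.mul continuous_const).tendsto s).mono_left nhdsWithin_le_nhds
      exact (this.eventually_const_lt hi).mono fun _ h => h.le
    · filter_upwards [hpos] with t ht
      exact hi.1.trans (mul_nonneg ht.le hi.2)
  obtain ⟨t, ⟨ht, hle⟩, hts⟩ := (key.and self_mem_nhdsWithin).exists
  exact (cwR_le_ofReal ht.le hle).trans_lt ((ENNReal.ofReal_lt_ofReal_iff hs).2 hts)

/-- `cwR` is quasiconvex along conic combinations of nonnegative vectors. -/
lemma cwR_add_smul_le {m n : ℕ} {A B : Matrix (Fin m) (Fin n) ℝ} {w x : Fin n → ℝ} {c : ℝ}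
    (hc : 0 ≤ c) (hw : ∀ i, 0 ≤ B.mulVec w i) (hx : ∀ i, 0 ≤ B.mulVec x i) :
    cwR A B (w + c • x) ≤ max (cwR A B w) (cwR A B x) := by
  rcases eq_or_ne (max (cwR A B w) (cwR A B x)) ⊤ with htop | htop
  · simp [htop]
  have hr := ENNReal.ofReal_toReal htop
  set r := (max (cwR A B w) (cwR A B x)).toReal
  have hr0 : 0 ≤ r := ENNReal.toReal_nonneg
  rw [← hr]
  refine cwR_le_ofReal hr0 fun i => ?_
  have h1 := mulVec_le_of_cwR_le hr0 hw (hr ▸ le_max_left _ _) i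
  have h2 := mulVec_le_of_cwR_le hr0 hx (hr ▸ le_max_right _ _) i
  simp only [mulVec_add, mulVec_smul, Pi.add_apply, Pi.smul_apply, smul_eq_mul]
  nlinarith [mul_le_mul_of_nonneg_left h2 hc]

lemma Matrix.mulVec_apply_nonneg {m n : ℕ} {B : Matrix (Fin m) (Fin n) ℝ}
    (hB : ∀ i j, 0 ≤ B i j) {x : Fin n → ℝ} (hx : ∀ j, 0 ≤ x j) (i : Fin m) :
    0 ≤ B.mulVec x i := by
  rw [mulVec, dotProduct]
  exact Finset.sum_nonneg fun j _ => mul_nonneg (hB i j) (hx j)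

/-- The approximability condition in `OptimalVec` passes from one optimal vector to any other
nonzero nonnegative vector attaining the quotient. -/
lemma OptimalVec.of_cwR_eq {m n : ℕ} {A B : Matrix (Fin m) (Fin n) ℝ} (hB : ∀ i j, 0 ≤ B i j)
    {y w : Fin n → ℝ} (hy : OptimalVec A B y) (hw : ∀ j, 0 ≤ w j) (hw0 : w ≠ 0)
    (h : cwR A B w = cwRho A B) : OptimalVec A B w := by
  obtain ⟨-, -, -, yk, hpos, hlim, hr⟩ := hy
  have hwk : ∀ (k : ℕ) j, 0 < (w + (1 / ((k : ℝ) + 1)) • yk k) j := fun k j =>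
    add_pos_of_nonneg_of_pos (hw j) (mul_pos (by positivity) (hpos k j))
  refine ⟨hw, hw0, h, fun k => w + (1 / ((k : ℝ) + 1)) • yk k, hwk, ?_, ?_⟩
  · simpa using tendsto_const_nhds.add
      ((tendsto_one_div_add_atTop_nhds_zero_nat (𝕜 := ℝ)).smul hlim)
  · refine tendsto_of_tendsto_of_tendsto_of_le_of_le tendsto_const_nhds hr
      (fun k => cwRho_le_cwR (hwk k)) fun k => ?_
    refine (cwR_add_smul_le (by positivity) (mulVec_apply_nonneg hB hw)
      (mulVec_apply_nonneg hB fun j => (hpos k j).le)).trans ?_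
    rw [h]
    exact max_le (cwRho_le_cwR (hpos k)) le_rfl

/-- At a vector attaining the quotient `ρ`, no direction supported on its support strictly
decreases all coordinates of `(A - ρ B) x`. -/
lemma OptimalVec.not_forall_mulVec_neg {m n : ℕ} (hm : 0 < m) {A B : Matrix (Fin m) (Fin n) ℝ}
    (hA : ∀ i j, 0 ≤ A i j) (hB : ∀ i j, 0 ≤ B i j) {y : Fin n → ℝ} (hy : OptimalVec A B y)
    {r : ℝ} (hr0 : 0 ≤ r) (hr : cwRho A B = ENNReal.ofReal r) {v : Fin n → ℝ}
    (hv : ∀ j, j ∉ suppS y → v j = 0) : ¬ ∀ i, (A - r • B).mulVec v i < 0 := by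
  intro hneg
  obtain ⟨hy0, -, hyr, -⟩ := hy
  have hCy : ∀ i, (A - r • B).mulVec y i ≤ 0 := fun i => by
    have := mulVec_le_of_cwR_le hr0 (mulVec_apply_nonneg hB hy0) (hyr.trans hr).le i
    simpa [sub_mulVec, smul_mulVec] using this
  let x : ℝ → Fin n → ℝ := fun e => y + e • (v + e • 1)
  have h1 : ∀ᶠ e in 𝓝[>] (0 : ℝ), ∀ j, 0 < x e j := by
    refine eventually_all.2 fun j => ?_
    by_cases hj : j ∈ suppS y
    · have hc : Continuous fun e => x e j := by
        simp only [x, Pi.add_apply, Pi.smul_apply, smul_eq_mul]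
        fun_prop
      have := (hc.tendsto 0).mono_left (nhdsWithin_le_nhds (s := Set.Ioi 0))
      exact this.eventually_const_lt (by simpa [x] using show 0 < y j from hj)
    · filter_upwards [self_mem_nhdsWithin] with e he
      have he' : 0 < e := he
      have := hy0 j
      simp only [x, Pi.add_apply, Pi.smul_apply, smul_eq_mul, hv j hj, Pi.one_apply]
      positivity
  have h2 : ∀ᶠ e in 𝓝[>] (0 : ℝ), ∀ i, (A - r • B).mulVec (x e) i < 0 := by
    refine eventually_all.2 fun i => ?_
    have hc : Continuous fun e : ℝ => (A - r • B).mulVec v i + e * (A - r • B).mulVec 1 i := by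
      fun_prop
    have := (hc.tendsto 0).mono_left (nhdsWithin_le_nhds (s := Set.Ioi 0))
    filter_upwards [self_mem_nhdsWithin, this.eventually_lt_const (by simpa using hneg i)]
      with e he hlt
    have := mul_neg_of_pos_of_neg (Set.mem_Ioi.1 he) hlt
    simp only [x, mulVec_add, mulVec_smul, Pi.add_apply, Pi.smul_apply, smul_eq_mul]
    linarith [hCy i]
  obtain ⟨e, hpos, hlt⟩ := (h1.and h2).exists
  have hlt' : ∀ i, A.mulVec (x e) i < r * B.mulVec (x e) i := fun i => by
    simpa [sub_mulVec, smul_mulVec] using hlt i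
  have hrpos : 0 < r := by
    have h3 := (mulVec_apply_nonneg hA (fun j => (hpos j).le) ⟨0, hm⟩).trans_lt (hlt' _)
    exact pos_of_mul_pos_left h3 (mulVec_apply_nonneg hB (fun j => (hpos j).le) _)
  exact ((cwRho_le_cwR hpos).trans_lt (cwR_lt_ofReal hrpos fun i => .inl (hlt' i))).ne hr

/-- There is a linear functional, nonzero at the optimal vector `y`, such that preserving its
value together with `(A - ρ B) y` prevents the Collatz-Wielandt value from dropping. -/
lemma OptimalVec.exists_functional {m n : ℕ} {A B : Matrix (Fin m) (Fin n) ℝ}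
    (hB : ∀ i j, 0 ≤ B i j) {y : Fin n → ℝ} (hy : OptimalVec A B y)
    {r : ℝ} (hr0 : 0 ≤ r) (hr : cwRho A B = ENNReal.ofReal r) :
    ∃ f : (Fin n → ℝ) →ₗ[ℝ] ℝ, f y ≠ 0 ∧ ∀ w : Fin n → ℝ, (∀ j, 0 ≤ w j) →
      (A - r • B).mulVec w = (A - r • B).mulVec y → f w = f y →
      ENNReal.ofReal r ≤ cwR A B w := by
  obtain ⟨hy0, hyne, hyr, -⟩ := hy
  rcases hr0.eq_or_lt with rfl | hrpos
  · refine ⟨∑ j, LinearMap.proj j, fun h0 => hyne ?_, fun w _ _ _ => by simp⟩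
    simp only [LinearMap.sum_apply, LinearMap.proj_apply] at h0
    ext j
    exact (Finset.sum_eq_zero_iff_of_nonneg fun j _ => hy0 j).1 h0 j (Finset.mem_univ j)
  have hle := mulVec_le_of_cwR_le hr0 (mulVec_apply_nonneg hB hy0) (hyr.trans hr).le
  obtain ⟨i, hi, hBi⟩ : ∃ i, A.mulVec y i = r * B.mulVec y i ∧ 0 < B.mulVec y i := by
    by_contra! hcon
    refine (cwR_lt_ofReal hrpos fun i => ?_).ne (hyr.trans hr)
    rcases (hle i).eq_or_lt with h | h
    · have hB0 := le_antisymm (hcon i h) (mulVec_apply_nonneg hB hy0 i)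
      exact .inr ⟨by simp [h, hB0], hB0.ge⟩
    · exact .inl h
  refine ⟨LinearMap.proj i ∘ₗ B.mulVecLin, by simpa using hBi.ne', fun w hw hCw hfw => ?_⟩
  refine le_of_not_gt fun hlt => ?_
  obtain ⟨_, ⟨s, -, rfl, hs⟩, hsr⟩ := sInf_lt_iff.1 hlt
  have hsr' := (ENNReal.ofReal_lt_ofReal_iff hrpos).1 hsr
  have hC := congrFun hCw i
  simp only [sub_mulVec, smul_mulVec, Pi.sub_apply, Pi.smul_apply, smul_eq_mul] at hC
  simp only [LinearMap.comp_apply, LinearMap.proj_apply, mulVecLin_apply] at hfw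
  have := hs i
  rw [hfw] at this hC
  nlinarith [mul_lt_mul_of_pos_right hsr' hBi]

/-- If `ρ(A,B) < ∞`, a minimal optimal vector has at most `m` positive coordinates. -/
theorem stmt14 {m n : ℕ} (hm : 0 < m) (hn : 0 < n)
    (A B : Matrix (Fin m) (Fin n) ℝ)
    (hA : ∀ i j, 0 ≤ A i j) (hB : ∀ i j, 0 ≤ B i j)
    (hfin : cwRho A B < ⊤)
    (y : Fin n → ℝ) (hy : MinOptimalVec A B y) :
    (suppS y).ncard ≤ m := by
  obtain ⟨hopt, hmin⟩ := hy
  obtain ⟨r, hr0, hr⟩ : ∃ r : ℝ, 0 ≤ r ∧ cwRho A B = ENNReal.ofReal r :=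
    ⟨_, ENNReal.toReal_nonneg, (ENNReal.ofReal_toReal hfin.ne).symm⟩
  obtain ⟨f, hfy, hf⟩ := hopt.exists_functional hB hr0 hr
  by_contra! hcard
  rcases exists_supported_ker_or_forall_exists ((A - r • B).mulVecLin.prod f) (suppS y)
    (by simpa using hcard) with ⟨z, hz, hzy, hLz⟩ | hsurj
  · obtain ⟨hCz, hfz⟩ := Prod.mk_eq_zero.1 hLz
    rw [mulVecLin_apply] at hCz
    obtain ⟨t, hw, hsub⟩ := exists_sub_smul_suppS_ssubset hopt.1 hz hzy
    have hCw : (A - r • B).mulVec (y - t • z) = (A - r • B).mulVec y := by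
      rw [mulVec_sub, mulVec_smul, hCz, smul_zero, sub_zero]
    have hfw : f (y - t • z) = f y := by simp [hfz]
    refine hmin _ (hopt.of_cwR_eq hB hw (fun h0 => hfy ?_) ?_) hsub
    · rw [← hfw, h0, map_zero]
    · rw [hr]
      refine le_antisymm (cwR_le_ofReal hr0 fun i => ?_) (hf _ hw hCw hfw)
      have hi := congrFun hCw i
      have hyi := mulVec_le_of_cwR_le hr0 (mulVec_apply_nonneg hB hopt.1)
        (hopt.2.2.1.trans hr).le i
      simp only [sub_mulVec A, smul_mulVec _ B, Pi.sub_apply, Pi.smul_apply, smul_eq_mul] at hi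
      linarith
  · obtain ⟨v, hv, hLv⟩ := hsurj (-1, 0)
    refine hopt.not_forall_mulVec_neg hm hA hB hr0 hr hv fun i => ?_
    have hi := congrFun (congrArg Prod.fst hLv) i
    simp only [LinearMap.prod_apply, Function.prod_apply, mulVecLin_apply] at hi
    simp [hi]
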